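/- arXiv:2101.01682 — 2 statements merged into one kernel-verified Lean document; each statement's English description precedes it below -/
import Mathlib

section
/- Bulk regime local limit theorem (Theorem 1.1(i)). Let (x_n)_{n≥1} be positive integers such that x_n/n converges to some γ ∈ (i_ξ, ρG'(ρ)/G(ρ)), where i_ξ = min{k ≥ 0 : P(ξ=k)>0}. For all n large enough let b_n ∈ (0,ρ) be defined by Ψ(b_n) = x_n/n, and set v_n² = n·Var(ξ^{(b_n)}) = n[(b_n²G''(b_n)+b_nG'(b_n))/G(b_n) − (b_nG'(b_n)/G(b_n))²]. Then sup_{k ≥ −x_n} | v_n · (b_n^{x_n+k}/G(b_n)^n) · P(S_n = x_n+k) − (2π)^{−1/2} exp(−k²/(2v_n²)) | → 0 as n → ∞. -/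
set_option autoImplicit false

open Filter Topology

/-- `convPow p n x` is the probability `P(S_n = x)` where `S_n = ξ_1 + ⋯ + ξ_n` is a sum of
`n` i.i.d. nonnegative-integer random variables with `P(ξ = k) = p k`. -/
noncomputable def convPow (p : ℕ → ℝ) : ℕ → ℕ → ℝ
  | 0, x => if x = 0 then 1 else 0
  | n + 1, x => ∑ j ∈ Finset.range (x + 1), convPow p n (x - j) * p j

/-- The generating function `G(s) = ∑_k p k s^k`. -/
noncomputable def genFun (p : ℕ → ℝ) (s : ℝ) : ℝ := ∑' k : ℕ, p k * s ^ k

/-- `Ψ(b) = b G'(b) / G(b)`, the mean of the tilted variable `ξ^{(b)}`. -/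
noncomputable def PsiFun (p : ℕ → ℝ) (b : ℝ) : ℝ :=
  b * deriv (genFun p) b / genFun p b


noncomputable def chf (q : ℕ → ℝ) (t : ℝ) : ℂ :=
  ∑' k : ℕ, (q k : ℂ) * Complex.exp (((k : ℝ) * t : ℝ) * Complex.I)

structure Good (q : ℕ → ℝ) (m s c M : ℝ) : Prop where
  nonneg : ∀ k, 0 ≤ q k
  sum1 : HasSum q 1
  mean : HasSum (fun k : ℕ => q k * ((k : ℝ) - m)) 0
  var : HasSum (fun k : ℕ => q k * ((k : ℝ) - m) ^ 2) s
  third : Summable (fun k : ℕ => q k * |(k : ℝ) - m| ^ 3)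
  third_le : ∑' k : ℕ, q k * |(k : ℝ) - m| ^ 3 ≤ M
  decay : ∀ t : ℝ, |t| ≤ Real.pi → c * t ^ 2 ≤ 1 - ‖chf q t‖

lemma hasSum_congr_C {f g : ℕ → ℂ} {a : ℂ} (h : ∀ k, f k = g k) : HasSum f a ↔ HasSum g a := by
  rw [funext h]

lemma exp_taylor3 (x : ℝ) :
    ‖Complex.exp (x * Complex.I) - (1 + x * Complex.I - x ^ 2 / 2)‖ ≤ 4 * |x| ^ 3 := by
  rcases le_total |x| 1 with h | h
  · have := Complex.exp_bound (x := x * Complex.I) (by simpa using h) (n := 3) (by norm_num)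
    have e : (1 + x * Complex.I - x ^ 2 / 2 : ℂ) =
        ∑ m ∈ Finset.range 3, (x * Complex.I) ^ m / m.factorial := by
      simp [Finset.sum_range_succ, mul_pow, Nat.factorial]
      ring
    rw [e]
    refine this.trans ?_
    have h0 := pow_nonneg (abs_nonneg x) 3
    simp [Nat.factorial]
    nlinarith
  · have h1 : ‖Complex.exp (x * Complex.I)‖ = 1 := Complex.norm_exp_ofReal_mul_I x
    have h2 : ‖(x * Complex.I : ℂ)‖ = |x| := by simp
    have h3 : ‖(x ^ 2 / 2 : ℂ)‖ = |x| ^ 2 / 2 := by simp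
    calc _ ≤ ‖Complex.exp (x * Complex.I)‖ + (‖(1 : ℂ)‖ + ‖(x * Complex.I : ℂ)‖ + ‖(x ^ 2 / 2 : ℂ)‖) :=
          (norm_sub_le _ _).trans (by gcongr; exact (norm_sub_le _ _).trans (by gcongr; exact norm_add_le _ _))
      _ = 1 + (1 + |x| + |x| ^ 2 / 2) := by rw [h1, h2, h3]; simp
      _ ≤ _ := by
        have : |x| ≤ |x| ^ 2 := by nlinarith
        have : |x| ^ 2 ≤ |x| ^ 3 := by nlinarith [sq_nonneg |x|]
        linarith

lemma exp_taylor2 (x : ℝ) :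
    ‖Complex.exp (x * Complex.I) - (1 + x * Complex.I)‖ ≤ 3 * x ^ 2 := by
  rcases le_total |x| 1 with h | h
  · have := Complex.exp_bound (x := x * Complex.I) (by simpa using h) (n := 2) (by norm_num)
    have e : (1 + x * Complex.I : ℂ) =
        ∑ m ∈ Finset.range 2, (x * Complex.I) ^ m / m.factorial := by
      simp [Finset.sum_range_succ, mul_pow, Nat.factorial]
    rw [e]
    refine this.trans ?_
    have h0 := sq_nonneg x
    simp [Nat.factorial]
    nlinarith
  · have h1 : ‖Complex.exp (x * Complex.I)‖ = 1 := Complex.norm_exp_ofReal_mul_I x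
    have h2 : ‖(x * Complex.I : ℂ)‖ = |x| := by simp
    calc _ ≤ ‖Complex.exp (x * Complex.I)‖ + (‖(1 : ℂ)‖ + ‖(x * Complex.I : ℂ)‖) :=
          (norm_sub_le _ _).trans (by gcongr; exact norm_add_le _ _)
      _ = 1 + (1 + |x|) := by rw [h1, h2]; simp
      _ ≤ _ := by
        rw [← sq_abs]
        have : |x| ≤ |x| ^ 2 := by nlinarith
        linarith

lemma summable_chf {q : ℕ → ℝ} (h0 : ∀ k, 0 ≤ q k) (h1 : Summable q) (f : ℕ → ℝ) :
    Summable (fun k : ℕ => (q k : ℂ) * Complex.exp ((f k : ℝ) * Complex.I)) := by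
  apply Summable.of_norm
  convert h1 using 2 with k
  rw [norm_mul, Complex.norm_exp_ofReal_mul_I]
  simp [abs_of_nonneg (h0 k)]

lemma norm_chf_le {q : ℕ → ℝ} (h0 : ∀ k, 0 ≤ q k) (h1 : HasSum q 1) (t : ℝ) : ‖chf q t‖ ≤ 1 := by
  refine tsum_of_norm_bounded h1 (fun k => ?_)
  rw [norm_mul, Complex.norm_exp_ofReal_mul_I]
  simp [abs_of_nonneg (h0 k)]

lemma continuous_chf {q : ℕ → ℝ} (h0 : ∀ k, 0 ≤ q k) (h1 : HasSum q 1) : Continuous (chf q) := by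
  refine continuous_tsum (fun k => by fun_prop) h1.summable (fun k t => ?_)
  rw [norm_mul, Complex.norm_exp_ofReal_mul_I]
  simp [abs_of_nonneg (h0 k)]

/-- centered characteristic function -/
noncomputable def cchf (q : ℕ → ℝ) (m t : ℝ) : ℂ := chf q t * Complex.exp ((-(m * t) : ℝ) * Complex.I)

lemma norm_cchf (q : ℕ → ℝ) (m t : ℝ) : ‖cchf q m t‖ = ‖chf q t‖ := by
  rw [cchf, norm_mul, Complex.norm_exp_ofReal_mul_I, mul_one]

lemma cchf_hasSum {q : ℕ → ℝ} (h0 : ∀ k, 0 ≤ q k) (h1 : HasSum q 1) (m t : ℝ) :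
    HasSum (fun k : ℕ => (q k : ℂ) * Complex.exp ((((k : ℝ) - m) * t : ℝ) * Complex.I))
      (cchf q m t) := by
  have := ((summable_chf h0 h1.summable (fun k => (k : ℝ) * t)).hasSum).mul_right
    (Complex.exp ((-(m * t) : ℝ) * Complex.I))
  refine (hasSum_congr_C (fun k => ?_)).2 this
  rw [mul_assoc, ← Complex.exp_add]
  congr 2
  push_cast
  ring

lemma Good.taylor2 {q : ℕ → ℝ} {m s c M : ℝ} (h : Good q m s c M) (t : ℝ) :
    ‖cchf q m t - 1‖ ≤ 3 * s * t ^ 2 := by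
  have H1 := cchf_hasSum h.nonneg h.sum1 m t
  have H2 : HasSum (fun k : ℕ => ((q k * 1 + q k * ((k : ℝ) - m) * t * 0 : ℝ) : ℂ)
      + ((q k * ((k : ℝ) - m) : ℝ) : ℂ) * (t * Complex.I)) (1 + ((0 : ℝ) : ℂ) * (t * Complex.I)) := by
    refine HasSum.add ?_ ((Complex.hasSum_ofReal.2 h.mean).mul_right _)
    simpa using Complex.hasSum_ofReal.2 h.sum1
  have H3 := H1.sub H2
  have H4 := (h.var.mul_left (3 * t ^ 2))
  have := H3.norm_le_of_bounded H4 (fun k => ?_)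
  · simp only [Complex.ofReal_zero, zero_mul, add_zero] at this
    linarith
  · have e := exp_taylor2 (((k : ℝ) - m) * t)
    calc _ = ‖(q k : ℂ) * (Complex.exp ((((k : ℝ) - m) * t : ℝ) * Complex.I)
          - (1 + ((((k : ℝ) - m) * t : ℝ) : ℂ) * Complex.I))‖ := by
            congr 1; push_cast; ring
      _ ≤ q k * (3 * (((k : ℝ) - m) * t) ^ 2) := by
        rw [norm_mul, Complex.norm_real, Real.norm_of_nonneg (h.nonneg k)]
        exact mul_le_mul_of_nonneg_left e (h.nonneg k)
      _ = _ := by ring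

lemma Good.taylor3 {q : ℕ → ℝ} {m s c M : ℝ} (h : Good q m s c M) (t : ℝ) :
    ‖cchf q m t - ((1 - s * t ^ 2 / 2 : ℝ) : ℂ)‖ ≤ 4 * M * |t| ^ 3 := by
  have H1 := cchf_hasSum h.nonneg h.sum1 m t
  have H2 : HasSum (fun k : ℕ => ((q k + q k * ((k : ℝ) - m) ^ 2 * (-t ^ 2 / 2) : ℝ) : ℂ)
      + ((q k * ((k : ℝ) - m) : ℝ) : ℂ) * (t * Complex.I))
      (((1 + s * (-t ^ 2 / 2) : ℝ) : ℂ) + ((0 : ℝ) : ℂ) * (t * Complex.I)) := by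
    refine HasSum.add ?_ ((Complex.hasSum_ofReal.2 h.mean).mul_right _)
    exact Complex.hasSum_ofReal.2 (h.sum1.add (h.var.mul_right _))
  have H3 := H1.sub H2
  have H4 := (h.third.hasSum.mul_left (4 * |t| ^ 3))
  have := H3.norm_le_of_bounded H4 (fun k => ?_)
  · simp only [Complex.ofReal_zero, zero_mul, add_zero] at this
    have e : (1 - s * t ^ 2 / 2 : ℝ) = 1 + s * (-t ^ 2 / 2) := by ring
    rw [e]
    refine this.trans ?_
    have := mul_le_mul_of_nonneg_left h.third_le (by positivity : 0 ≤ 4 * |t| ^ 3)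
    linarith
  · have e := exp_taylor3 (((k : ℝ) - m) * t)
    calc _ = ‖(q k : ℂ) * (Complex.exp ((((k : ℝ) - m) * t : ℝ) * Complex.I)
          - (1 + ((((k : ℝ) - m) * t : ℝ) : ℂ) * Complex.I - ((((k : ℝ) - m) * t : ℝ) : ℂ) ^ 2 / 2))‖ := by
            congr 1; push_cast; ring
      _ ≤ q k * (4 * |((k : ℝ) - m) * t| ^ 3) := by
        rw [norm_mul, Complex.norm_real, Real.norm_of_nonneg (h.nonneg k)]
        exact mul_le_mul_of_nonneg_left e (h.nonneg k)
      _ = _ := by rw [abs_mul]; ring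

lemma Good.s_lower {q : ℕ → ℝ} {m s c M : ℝ} (h : Good q m s c M) : c / 3 ≤ s := by
  have h1 := h.taylor2 1
  have h2 := h.decay 1 (by rw [abs_one]; linarith [Real.pi_gt_three])
  have h3 : 1 - ‖chf q 1‖ ≤ ‖cchf q m 1 - 1‖ := by
    rw [← norm_cchf q m, norm_sub_rev]
    have := norm_sub_norm_le (1 : ℂ) (cchf q m 1)
    simpa using this
  linarith

lemma Good.s_upper {q : ℕ → ℝ} {m s c M : ℝ} (h : Good q m s c M) : s ≤ 1 + M := by
  refine (hasSum_le (fun k => ?_) h.var (h.sum1.add h.third.hasSum)).trans (by linarith [h.third_le])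
  have h0 := h.nonneg k
  have : ((k : ℝ) - m) ^ 2 ≤ 1 + |(k : ℝ) - m| ^ 3 := by
    rw [← sq_abs]
    set y := |(k : ℝ) - m|
    have hy : 0 ≤ y := abs_nonneg _
    rcases le_total y 1 with h | h
    · have := pow_nonneg hy 3
      nlinarith
    · nlinarith [sq_nonneg y]
  calc _ ≤ q k * (1 + |(k : ℝ) - m| ^ 3) := mul_le_mul_of_nonneg_left this h0
    _ = _ := by ring

lemma exp_neg_bound (y : ℝ) (hy : 0 ≤ y) : |Real.exp (-y) - (1 - y)| ≤ y ^ 2 := by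
  have h1 : 1 - y ≤ Real.exp (-y) := Real.one_sub_le_exp_neg y
  have h2 : Real.exp (-y) ≤ 1 / (1 + y) := by
    rw [Real.exp_neg, ← one_div]
    exact one_div_le_one_div_of_le (by linarith) (by linarith [Real.add_one_le_exp y])
  have h3 : 1 / (1 + y) ≤ 1 - y + y ^ 2 := by
    rw [div_le_iff₀ (by linarith)]
    nlinarith [pow_nonneg hy 3]
  rw [abs_of_nonneg (by linarith)]
  linarith

lemma norm_pow_sub_pow_le_of {z w : ℂ} (hz : ‖z‖ ≤ 1) (hw : ‖w‖ ≤ 1) (n : ℕ) :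
    ‖z ^ n - w ^ n‖ ≤ n * ‖z - w‖ := by
  induction n with
  | zero => simp
  | succ n ih =>
    have : z ^ (n + 1) - w ^ (n + 1) = (z ^ n - w ^ n) * z + w ^ n * (z - w) := by ring
    rw [this]
    refine (norm_add_le _ _).trans ?_
    rw [norm_mul, norm_mul, norm_pow]
    have h1 : ‖w‖ ^ n ≤ 1 := pow_le_one₀ (norm_nonneg _) hw
    have h2 := mul_le_mul ih hz (norm_nonneg _) (by positivity)
    have h3 := mul_le_mul_of_nonneg_right h1 (norm_nonneg (z - w))
    push_cast
    linarith

lemma Good.pow_close {q : ℕ → ℝ} {m s c M : ℝ} (h : Good q m s c M) (hs : 0 ≤ s) (t : ℝ) (n : ℕ) :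
    ‖cchf q m t ^ n - ((Real.exp (-(n * (s * t ^ 2 / 2))) : ℝ) : ℂ)‖ ≤
      n * (4 * M * |t| ^ 3 + (s * t ^ 2 / 2) ^ 2) := by
  have hy : 0 ≤ s * t ^ 2 / 2 := by positivity
  have e : ((Real.exp (-(n * (s * t ^ 2 / 2))) : ℝ) : ℂ) = ((Real.exp (-(s * t ^ 2 / 2)) : ℝ) : ℂ) ^ n := by
    rw [← Complex.ofReal_pow, ← Real.exp_nat_mul]
    congr 2; ring
  rw [e]
  refine (norm_pow_sub_pow_le_of ?_ ?_ n).trans ?_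
  · rw [norm_cchf]; exact norm_chf_le h.nonneg h.sum1 t
  · rw [Complex.norm_real, Real.norm_of_nonneg (Real.exp_pos _).le]
    exact Real.exp_le_one_iff.2 (by linarith)
  · gcongr
    have h1 := h.taylor3 t
    have h2 := exp_neg_bound _ hy
    rw [← Real.norm_eq_abs, ← Complex.norm_real, ← norm_neg] at h2
    refine le_trans (le_of_eq ?_) ((norm_add_le _ _).trans (add_le_add h1 h2))
    congr 1
    push_cast
    ring

lemma Good.pow_bound {q : ℕ → ℝ} {m s c M : ℝ} (h : Good q m s c M) (t : ℝ) (ht : |t| ≤ Real.pi) (n : ℕ) :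
    ‖cchf q m t ^ n‖ ≤ Real.exp (-(n * (c * t ^ 2))) := by
  rw [norm_pow, norm_cchf]
  have h1 : ‖chf q t‖ ≤ Real.exp (-(c * t ^ 2)) :=
    le_trans (by linarith [h.decay t ht]) (Real.one_sub_le_exp_neg _)
  calc _ ≤ Real.exp (-(c * t ^ 2)) ^ n := pow_le_pow_left₀ (norm_nonneg _) h1 n
    _ = _ := by rw [← Real.exp_nat_mul]; congr 1; ring


lemma convPow_nonneg {q : ℕ → ℝ} (h0 : ∀ k, 0 ≤ q k) (n j : ℕ) : 0 ≤ convPow q n j := by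
  induction n generalizing j with
  | zero => rw [convPow]; split_ifs <;> norm_num
  | succ n ih => rw [convPow]; exact Finset.sum_nonneg (fun i _ => mul_nonneg (ih _) (h0 _))

lemma convPow_tilt (p : ℕ → ℝ) {b G : ℝ} (hG : G ≠ 0) (n j : ℕ) :
    convPow (fun k => p k * b ^ k / G) n j = b ^ j / G ^ n * convPow p n j := by
  induction n generalizing j with
  | zero =>
    simp only [convPow]
    split_ifs with h
    · simp [h]
    · simp
  | succ n ih =>
    simp only [convPow, Finset.mul_sum]
    refine Finset.sum_congr rfl (fun i hi => ?_)
    have hi' : i ≤ j := Nat.lt_succ_iff.1 (Finset.mem_range.1 hi)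
    rw [ih]
    obtain ⟨d, rfl⟩ := Nat.exists_eq_add_of_le hi'
    rw [Nat.add_sub_cancel_left]
    field_simp
    ring

lemma convPow_hasSum {q : ℕ → ℝ} (h0 : ∀ k, 0 ≤ q k) (h1 : Summable q) (z : ℂ) (hz : ‖z‖ ≤ 1) (n : ℕ) :
    Summable (fun j => ‖(convPow q n j : ℂ) * z ^ j‖) ∧
    HasSum (fun j => (convPow q n j : ℂ) * z ^ j) ((∑' k, (q k : ℂ) * z ^ k) ^ n) := by
  have hq : Summable (fun k => ‖(q k : ℂ) * z ^ k‖) := by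
    refine Summable.of_nonneg_of_le (fun _ => norm_nonneg _) (fun k => ?_) h1
    rw [norm_mul, Complex.norm_real, Real.norm_of_nonneg (h0 k), norm_pow]
    exact mul_le_of_le_one_right (h0 k) (pow_le_one₀ (norm_nonneg _) hz)
  induction n with
  | zero =>
    constructor
    · refine summable_of_ne_finset_zero (s := {0}) (fun j hj => ?_)
      have : j ≠ 0 := by simpa using hj
      simp [convPow, this]
    · rw [pow_zero]
      convert hasSum_ite_eq (0 : ℕ) (1 : ℂ) using 2 with j
      by_cases h : j = 0 <;> simp [convPow, h]
  | succ n ih =>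
    have e : (fun j => (convPow q (n + 1) j : ℂ) * z ^ j) = fun j =>
        ∑ i ∈ Finset.range (j + 1), ((q i : ℂ) * z ^ i) * ((convPow q n (j - i) : ℂ) * z ^ (j - i)) := by
      funext j
      rw [convPow, Complex.ofReal_sum, Finset.sum_mul]
      refine Finset.sum_congr rfl (fun i hi => ?_)
      have hi' : i ≤ j := Nat.lt_succ_iff.1 (Finset.mem_range.1 hi)
      obtain ⟨d, rfl⟩ := Nat.exists_eq_add_of_le hi'
      rw [Nat.add_sub_cancel_left]
      push_cast
      ring
    constructor
    · have := summable_norm_sum_mul_range_of_summable_norm hq ih.1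
      exact (summable_congr (fun j => congrArg norm (congrFun e j))).2 this
    · have := hasSum_sum_range_mul_of_summable_norm hq ih.1
      rw [ih.2.tsum_eq, ← pow_succ'] at this
      rw [e]
      exact this

lemma integral_exp_int (m : ℤ) :
    ∫ t in (-Real.pi)..Real.pi, Complex.exp (((m : ℝ) * t : ℝ) * Complex.I) =
      if m = 0 then (2 * Real.pi : ℂ) else 0 := by
  split_ifs with h
  · subst h
    simp
    ring
  · have hc : (m * Complex.I : ℂ) ≠ 0 := mul_ne_zero (by exact_mod_cast h) Complex.I_ne_zero
    have := integral_exp_mul_complex (a := -Real.pi) (b := Real.pi) hc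
    calc _ = ∫ t in (-Real.pi)..Real.pi, Complex.exp (m * Complex.I * t) := by
          congr 1; funext t; congr 1; push_cast; ring
      _ = _ := by
        rw [this]
        have : Complex.exp (m * Complex.I * Real.pi) = Complex.exp (m * Complex.I * (-Real.pi : ℝ)) := by
          rw [Complex.exp_eq_exp_iff_exists_int]
          exact ⟨m, by push_cast; ring⟩
        rw [this]; simp

lemma inversion {q : ℕ → ℝ} (h0 : ∀ k, 0 ≤ q k) (h1 : HasSum q 1) (n j : ℕ) :
    ∫ t in (-Real.pi)..Real.pi, chf q t ^ n * Complex.exp ((-((j : ℝ) * t) : ℝ) * Complex.I) =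
      2 * Real.pi * (convPow q n j : ℂ) := by
  have hS : Summable (fun l => convPow q n l) := by
    have := (convPow_hasSum h0 h1.summable 1 (by simp) n).1
    simpa [abs_of_nonneg (convPow_nonneg h0 n _)] using this
  have key : HasSum (fun l : ℕ => ∫ t in (-Real.pi)..Real.pi,
      (convPow q n l : ℂ) * Complex.exp ((((l - j : ℤ) : ℝ) * t : ℝ) * Complex.I))
      (∫ t in (-Real.pi)..Real.pi, chf q t ^ n * Complex.exp ((-((j : ℝ) * t) : ℝ) * Complex.I)) := by
    refine intervalIntegral.hasSum_integral_of_dominated_convergence (fun l _ => convPow q n l)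
      (fun l => ?_) (fun l => ?_) ?_ ?_ ?_
    · exact (Continuous.aestronglyMeasurable (by fun_prop))
    · refine Filter.Eventually.of_forall (fun t _ => ?_)
      rw [norm_mul, Complex.norm_exp_ofReal_mul_I, Complex.norm_real,
        Real.norm_of_nonneg (convPow_nonneg h0 n l), mul_one]
    · exact Filter.Eventually.of_forall (fun t _ => hS)
    · exact intervalIntegrable_const
    · refine Filter.Eventually.of_forall (fun t _ => ?_)
      have := (convPow_hasSum h0 h1.summable (Complex.exp (t * Complex.I))
        (Complex.norm_exp_ofReal_mul_I t).le n).2.mul_right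
          (Complex.exp ((-((j : ℝ) * t) : ℝ) * Complex.I))
      have e : chf q t = ∑' k, (q k : ℂ) * Complex.exp (t * Complex.I) ^ k := by
        unfold chf
        congr 1; funext k
        rw [← Complex.exp_nat_mul]
        congr 2
        push_cast; ring
      rw [e]
      refine (hasSum_congr_C (fun k => ?_)).2 this
      rw [mul_assoc, ← Complex.exp_nat_mul, ← Complex.exp_add]
      congr 2
      push_cast; ring
  refine key.unique ?_
  simp_rw [intervalIntegral.integral_const_mul, integral_exp_int]
  convert hasSum_single j (fun l hl => ?_) using 1
  · simp; ring
  · have : (l - j : ℤ) ≠ 0 := by omega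
    simp [this]

lemma gaussian_fourier (y : ℝ) :
    ∫ u : ℝ, ((Real.exp (-(u ^ 2 / 2)) : ℝ) : ℂ) * Complex.exp ((-(y * u) : ℝ) * Complex.I) =
      ((Real.sqrt (2 * Real.pi) * Real.exp (-y ^ 2 / 2) : ℝ) : ℂ) := by
  have := fourierIntegral_gaussian (b := 1 / 2) (by norm_num) (-y : ℂ)
  calc _ = ∫ x : ℝ, Complex.exp (Complex.I * (-y) * x) * Complex.exp (-(1 / 2) * (x : ℂ) ^ 2) := by
        congr 1; funext u
        rw [mul_comm]
        push_cast
        congr 2 <;> ring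
    _ = _ := by
      rw [this]
      have h2 : ((Real.pi : ℂ) / (1 / 2)) ^ (1 / 2 : ℂ) = ((Real.sqrt (2 * Real.pi) : ℝ) : ℂ) := by
        rw [Real.sqrt_eq_rpow, Complex.ofReal_cpow (by positivity)]
        congr 1
        · push_cast; ring
        · push_cast; ring
      rw [h2]
      push_cast
      congr 2
      ring

/-- rescaled, truncated power of the centered characteristic function -/
noncomputable def Ffun (q : ℕ → ℝ) (m v : ℝ) (n : ℕ) (u : ℝ) : ℂ :=
  (Set.Ioc (-Real.pi * v) (Real.pi * v)).indicator (fun u => cchf q m (u / v) ^ n) u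

lemma inversion_scaled {q : ℕ → ℝ} (h0 : ∀ k, 0 ≤ q k) (h1 : HasSum q 1) (m v : ℝ) (hv : 0 < v) (n j : ℕ) :
    ∫ u : ℝ, Ffun q m v n u * Complex.exp ((-(((j : ℝ) - n * m) / v * u) : ℝ) * Complex.I) =
      2 * Real.pi * (v * convPow q n j : ℝ) := by
  have e1 : ∀ u : ℝ, Ffun q m v n u * Complex.exp ((-(((j : ℝ) - n * m) / v * u) : ℝ) * Complex.I) =
      (Set.Ioc (-Real.pi * v) (Real.pi * v)).indicator (fun u => chf q (u / v) ^ n *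
        Complex.exp ((-((j : ℝ) * (u / v)) : ℝ) * Complex.I)) u := by
    intro u
    unfold Ffun Set.indicator
    split_ifs
    · beta_reduce
      rw [cchf, mul_pow, mul_assoc, ← Complex.exp_nat_mul, ← Complex.exp_add]
      congr 2
      push_cast
      field_simp
      ring
    · simp
  simp_rw [e1]
  rw [MeasureTheory.integral_indicator measurableSet_Ioc,
    ← intervalIntegral.integral_of_le (by nlinarith [Real.pi_pos])]
  have := intervalIntegral.integral_comp_div (a := -Real.pi * v) (b := Real.pi * v)
    (fun t => chf q t ^ n * Complex.exp ((-((j : ℝ) * t) : ℝ) * Complex.I)) hv.ne'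
  rw [this, mul_div_cancel_right₀ _ hv.ne', mul_div_cancel_right₀ _ hv.ne', inversion h0 h1]
  rw [Complex.real_smul]
  push_cast
  ring

lemma integrable_gauss : MeasureTheory.Integrable (fun u : ℝ => Real.exp (-(u ^ 2 / 2))) := by
  convert integrable_exp_neg_mul_sq (b := 1 / 2) (by norm_num) using 2 with u
  ring_nf

lemma norm_Ffun_le {q : ℕ → ℝ} {m s c M : ℝ} (h : Good q m s c M) (hc : 0 < c)
    {v : ℝ} {n : ℕ} (hv : 0 < v) (hvs : v ^ 2 = n * s) (u : ℝ) :
    ‖Ffun q m v n u‖ ≤ Real.exp (-(c / (1 + M)) * u ^ 2) := by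
  unfold Ffun Set.indicator
  split_ifs with hu
  · refine (h.pow_bound _ ?_ n).trans (Real.exp_le_exp.2 ?_)
    · rw [abs_div, abs_of_pos hv, div_le_iff₀ hv, abs_le]
      exact ⟨by linarith [hu.1], hu.2⟩
    · have hn : (n : ℝ) ≠ 0 := by
        rintro hn; rw [hn] at hvs; nlinarith [pow_pos hv 2]
      have hs : 0 < s := lt_of_lt_of_le (by positivity) h.s_lower
      rw [div_pow, hvs]
      have : (n : ℝ) * (c * (u ^ 2 / (n * s))) = c * u ^ 2 / s := by field_simp
      rw [this]
      have h2 : c * u ^ 2 / (1 + M) ≤ c * u ^ 2 / s :=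
        div_le_div_of_nonneg_left (by positivity) hs h.s_upper
      calc -(c * u ^ 2 / s) ≤ -(c * u ^ 2 / (1 + M)) := by linarith
        _ = _ := by ring
  · simp only [norm_zero]; positivity

lemma measurable_Ffun {q : ℕ → ℝ} {m s c M : ℝ} (h : Good q m s c M) (v : ℝ) (n : ℕ) :
    MeasureTheory.AEStronglyMeasurable (Ffun q m v n) MeasureTheory.volume := by
  refine MeasureTheory.AEStronglyMeasurable.indicator ?_ measurableSet_Ioc
  have := continuous_chf h.nonneg h.sum1
  apply Continuous.aestronglyMeasurable
  unfold cchf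
  fun_prop

lemma Ffun_close {q : ℕ → ℝ} {m s c M : ℝ} (h : Good q m s c M) (hc : 0 < c) (hM : 0 ≤ M)
    {v : ℝ} {n : ℕ} (hv : 0 < v) (hvs : v ^ 2 = n * s) (u : ℝ) (hu : |u| < Real.pi * v) :
    ‖Ffun q m v n u - ((Real.exp (-(u ^ 2 / 2)) : ℝ) : ℂ)‖ ≤
      12 * M / c * |u| ^ 3 * v⁻¹ + (1 + M) * u ^ 4 * v⁻¹ ^ 2 := by
  have hu' := abs_lt.1 hu
  have hs : 0 < s := lt_of_lt_of_le (by positivity) h.s_lower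
  have hn : (n : ℝ) ≠ 0 := by
    rintro hn; rw [hn] at hvs; nlinarith [pow_pos hv 2]
  have hn' : 0 < (n : ℝ) := lt_of_le_of_ne (by positivity) hn.symm
  have hmem : u ∈ Set.Ioc (-Real.pi * v) (Real.pi * v) := ⟨by linarith, hu'.2.le⟩
  unfold Ffun
  rw [Set.indicator_of_mem hmem]
  have := h.pow_close hs.le (u / v) n
  have e : (n : ℝ) * (s * (u / v) ^ 2 / 2) = u ^ 2 / 2 := by
    rw [div_pow, hvs]; field_simp
  rw [e] at this
  refine this.trans ?_
  have hnv : (n : ℝ) = v ^ 2 / s := by rw [hvs]; field_simp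
  rw [abs_div, abs_of_pos hv, hnv]
  have e1 : v ^ 2 / s * (4 * M * (|u| / v) ^ 3 + (s * (u / v) ^ 2 / 2) ^ 2)
     = 4 * M / s * |u| ^ 3 * v⁻¹ + s / 4 * u ^ 4 * v⁻¹ ^ 2 := by
    field_simp
    ring
  rw [e1]
  have hs2 := h.s_upper
  have h1 : 4 * M / s ≤ 12 * M / c := by
    rw [div_le_div_iff₀ hs hc]
    nlinarith [h.s_lower]
  have h2 : s / 4 ≤ 1 + M := by linarith
  gcongr

theorem uniform_llt (q : ℕ → ℕ → ℝ) (m s v : ℕ → ℝ) (c M : ℝ) (hc : 0 < c) (hM : 0 ≤ M)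
    (h : ∀ᶠ n in atTop, Good (q n) (m n) (s n) c M)
    (hv0 : ∀ n, 0 ≤ v n) (hv : ∀ᶠ n in atTop, v n ^ 2 = n * s n) :
    ∀ ε > 0, ∀ᶠ n in atTop, ∀ j : ℕ,
      |v n * convPow (q n) n j - (Real.sqrt (2 * Real.pi))⁻¹ *
          Real.exp (-((j : ℝ) - n * m n) ^ 2 / (2 * (v n) ^ 2))| < ε := by
  have hvtop : Tendsto v atTop atTop := by
    have h1 : Tendsto (fun n : ℕ => Real.sqrt (n * (c / 3))) atTop atTop :=
      Real.tendsto_sqrt_atTop.comp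
        ((tendsto_natCast_atTop_atTop).atTop_mul_const (by positivity))
    refine tendsto_atTop_mono' _ ?_ h1
    filter_upwards [h, hv] with n hn hvn
    refine Real.sqrt_le_iff.2 ⟨hv0 n, ?_⟩
    rw [hvn]
    have := hn.s_lower
    gcongr
  have hvpos : ∀ᶠ n in atTop, 0 < v n := hvtop.eventually_gt_atTop 0
  set F : ℕ → ℝ → ℝ := fun n u => ‖Ffun (q n) (m n) (v n) n u - ((Real.exp (-(u ^ 2 / 2)) : ℝ) : ℂ)‖
  have hcont : Continuous (fun u : ℝ => ((Real.exp (-(u ^ 2 / 2)) : ℝ) : ℂ)) := by fun_prop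
  have hlim : Tendsto (fun n => ∫ u, F n u) atTop (𝓝 (∫ u : ℝ, (0 : ℝ))) := by
    refine MeasureTheory.tendsto_integral_filter_of_dominated_convergence
      (fun u => Real.exp (-(c / (1 + M)) * u ^ 2) + Real.exp (-(u ^ 2 / 2))) ?_ ?_ ?_ ?_
    · filter_upwards [h] with n hn
      exact ((measurable_Ffun hn _ _).sub hcont.aestronglyMeasurable).norm
    · filter_upwards [h, hv, hvpos] with n hn hvn hvp
      refine Filter.Eventually.of_forall (fun u => ?_)
      rw [norm_norm]
      refine (norm_sub_le _ _).trans (add_le_add (norm_Ffun_le hn hc hvp hvn u) ?_)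
      rw [Complex.norm_real, Real.norm_of_nonneg (Real.exp_pos _).le]
    · exact (integrable_exp_neg_mul_sq (by positivity)).add integrable_gauss
    · refine Filter.Eventually.of_forall (fun u => ?_)
      have hb : Tendsto (fun n => 12 * M / c * |u| ^ 3 * (v n)⁻¹ + (1 + M) * u ^ 4 * (v n)⁻¹ ^ 2)
          atTop (𝓝 (12 * M / c * |u| ^ 3 * 0 + (1 + M) * u ^ 4 * 0 ^ 2)) := by
        have := hvtop.inv_tendsto_atTop
        exact (this.const_mul _).add ((this.pow 2).const_mul _)
      have e0 : 12 * M / c * |u| ^ 3 * 0 + (1 + M) * u ^ 4 * 0 ^ 2 = (0 : ℝ) := by ring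
      rw [e0] at hb
      refine squeeze_zero' (Filter.Eventually.of_forall (fun n => norm_nonneg _)) ?_ hb
      filter_upwards [h, hv, hvpos, hvtop.eventually_gt_atTop (|u| / Real.pi)] with n hn hvn hvp hvu
      refine Ffun_close hn hc hM hvp hvn u ?_
      rw [div_lt_iff₀ Real.pi_pos] at hvu
      linarith
  rw [MeasureTheory.integral_zero] at hlim
  intro ε hε
  filter_upwards [h, hv, hvpos, hlim.eventually_lt_const hε] with n hn hvn hvp hlt j
  set y := ((j : ℝ) - n * m n) / v n with hy
  have I1 := inversion_scaled hn.nonneg hn.sum1 (m n) (v n) hvp n j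
  have I2 := gaussian_fourier y
  rw [← hy] at I1
  have hexp : Continuous (fun u : ℝ => Complex.exp ((-(y * u) : ℝ) * Complex.I)) := by fun_prop
  have nexp : ∀ u : ℝ, ‖Complex.exp ((-(y * u) : ℝ) * Complex.I)‖ = 1 :=
    fun u => Complex.norm_exp_ofReal_mul_I _
  have J1 : MeasureTheory.Integrable (fun u : ℝ => Ffun (q n) (m n) (v n) n u *
      Complex.exp ((-(y * u) : ℝ) * Complex.I)) := by
    refine MeasureTheory.Integrable.mono' (integrable_exp_neg_mul_sq (b := c / (1 + M)) (by positivity))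
      ((measurable_Ffun hn _ _).mul hexp.aestronglyMeasurable)
      (Filter.Eventually.of_forall (fun u => ?_))
    rw [norm_mul, nexp, mul_one]
    exact norm_Ffun_le hn hc hvp hvn u
  have J2 : MeasureTheory.Integrable (fun u : ℝ => ((Real.exp (-(u ^ 2 / 2)) : ℝ) : ℂ) *
      Complex.exp ((-(y * u) : ℝ) * Complex.I)) := by
    refine MeasureTheory.Integrable.mono' integrable_gauss
      (hcont.aestronglyMeasurable.mul hexp.aestronglyMeasurable)
      (Filter.Eventually.of_forall (fun u => ?_))
    rw [norm_mul, nexp, mul_one, Complex.norm_real, Real.norm_of_nonneg (Real.exp_pos _).le]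
  have K := MeasureTheory.integral_sub J1 J2
  rw [I1, I2] at K
  have K2 : ‖2 * Real.pi * ((v n * convPow (q n) n j : ℝ) : ℂ)
      - ((Real.sqrt (2 * Real.pi) * Real.exp (-y ^ 2 / 2) : ℝ) : ℂ)‖ < ε := by
    rw [← K]
    refine lt_of_le_of_lt (MeasureTheory.norm_integral_le_integral_norm _) ?_
    refine lt_of_le_of_lt (le_of_eq ?_) hlt
    refine MeasureTheory.integral_congr_ae (Filter.Eventually.of_forall (fun u => ?_))
    beta_reduce
    rw [← sub_mul, norm_mul, nexp, mul_one]
  have hpi : (1 : ℝ) < 2 * Real.pi := by linarith [Real.pi_gt_three]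
  have hsq : Real.sqrt (2 * Real.pi) ^ 2 = 2 * Real.pi := Real.sq_sqrt (by positivity)
  have hsp : 0 < Real.sqrt (2 * Real.pi) := Real.sqrt_pos.2 (by positivity)
  have e2 : -((j : ℝ) - n * m n) ^ 2 / (2 * (v n) ^ 2) = -y ^ 2 / 2 := by
    rw [hy]; field_simp
  rw [e2]
  set A := v n * convPow (q n) n j
  set E := Real.exp (-y ^ 2 / 2)
  have e3 : 2 * Real.pi * ((A : ℝ) : ℂ) - ((Real.sqrt (2 * Real.pi) * E : ℝ) : ℂ) =
      ((2 * Real.pi * (A - (Real.sqrt (2 * Real.pi))⁻¹ * E) : ℝ) : ℂ) := by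
    have : Real.sqrt (2 * Real.pi) * E = 2 * Real.pi * ((Real.sqrt (2 * Real.pi))⁻¹ * E) := by
      nth_rewrite 2 [← hsq]
      field_simp
    rw [this]
    push_cast
    ring
  rw [e3, Complex.norm_real, Real.norm_eq_abs, abs_mul, abs_of_pos (by positivity)] at K2
  have := abs_nonneg (A - (Real.sqrt (2 * Real.pi))⁻¹ * E)
  nlinarith


lemma hasSum_of_eq {f g : ℕ → ℝ} {a c : ℝ} (h : HasSum f a) (hf : ∀ k, g k = f k) (ha : c = a) :
    HasSum g c := by
  rw [funext hf, ha]; exact h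

lemma norm_two (x y a b : ℝ) :
    ‖(x : ℂ) * Complex.exp (a * Complex.I) + (y : ℂ) * Complex.exp (b * Complex.I)‖ ^ 2 =
      (x + y) ^ 2 - 4 * (x * y) * Real.sin ((a - b) / 2) ^ 2 := by
  have h1 : Real.sin ((a - b) / 2) ^ 2 = (1 - Real.cos (a - b)) / 2 := by
    rw [Real.sin_sq_eq_half_sub]
    ring_nf
  rw [h1, Real.cos_sub, Complex.sq_norm, Complex.normSq_apply]
  simp only [Complex.add_re, Complex.add_im, Complex.re_ofReal_mul, Complex.im_ofReal_mul,
    Complex.exp_ofReal_mul_I_re, Complex.exp_ofReal_mul_I_im]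
  have ha := Real.sin_sq_add_cos_sq a
  have hb := Real.sin_sq_add_cos_sq b
  linear_combination x ^ 2 * ha + y ^ 2 * hb

lemma pair_decay {q : ℕ → ℝ} (h0 : ∀ k, 0 ≤ q k) (h1 : HasSum q 1) (k l : ℕ) (hkl : k ≠ l) (t : ℝ) :
    2 * (q k * q l) * Real.sin (((k : ℤ) - (l : ℤ) : ℤ) * t / 2) ^ 2 ≤ 1 - ‖chf q t‖ := by
  classical
  set f : ℕ → ℂ := fun k => (q k : ℂ) * Complex.exp (((k : ℝ) * t : ℝ) * Complex.I) with hf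
  have hfs : HasSum f (chf q t) := (summable_chf h0 h1.summable (fun k => (k : ℝ) * t)).hasSum
  have A1 : HasSum (fun i => if i ∈ ({k, l} : Finset ℕ) then f i else 0) (f k + f l) := by
    have := hasSum_sum_of_ne_finset_zero (L := SummationFilter.unconditional ℕ) (s := ({k, l} : Finset ℕ))
      (f := fun i => if i ∈ ({k, l} : Finset ℕ) then f i else 0) (fun i hi => if_neg hi)
    rw [Finset.sum_pair hkl] at this
    simpa using this
  have A2 : HasSum (fun i => if i ∈ ({k, l} : Finset ℕ) then q i else 0) (q k + q l) := by
    have := hasSum_sum_of_ne_finset_zero (L := SummationFilter.unconditional ℕ) (s := ({k, l} : Finset ℕ))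
      (f := fun i => if i ∈ ({k, l} : Finset ℕ) then q i else 0) (fun i hi => if_neg hi)
    rw [Finset.sum_pair hkl] at this
    simpa using this
  have A3 : ‖chf q t - (f k + f l)‖ ≤ 1 - (q k + q l) := by
    refine (hfs.sub A1).norm_le_of_bounded (h1.sub A2) (fun i => ?_)
    split_ifs
    · simp
    · simp only [sub_zero, hf]
      rw [norm_mul, Complex.norm_exp_ofReal_mul_I, Complex.norm_real, Real.norm_of_nonneg (h0 i), mul_one]
  have hle : q k + q l ≤ 1 := by
    have := (norm_nonneg _).trans A3; linarith
  have A4 := norm_two (q k) (q l) ((k : ℝ) * t) ((l : ℝ) * t)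
  have e : (((k : ℤ) - (l : ℤ) : ℤ) : ℝ) * t / 2 = ((k : ℝ) * t - (l : ℝ) * t) / 2 := by
    push_cast; ring
  rw [e]
  set X := Real.sin (((k : ℝ) * t - (l : ℝ) * t) / 2) ^ 2 with hX
  have hX0 : 0 ≤ X := sq_nonneg _
  have hX1 : X ≤ 1 := Real.sin_sq_le_one _
  have hk := h0 k
  have hl := h0 l
  have hP : 0 ≤ q k * q l := mul_nonneg hk hl
  have hPX : q k * q l * X ≤ q k * q l := mul_le_of_le_one_right hP hX1
  have hPX0 : 0 ≤ q k * q l * X := mul_nonneg hP hX0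
  have hpos : 0 ≤ (q k + q l) - 2 * (q k * q l * X) := by nlinarith
  have A5 : ‖f k + f l‖ ≤ (q k + q l) - 2 * (q k * q l * X) := by
    refine (sq_le_sq₀ (norm_nonneg _) hpos).1 ?_
    have : ‖f k + f l‖ ^ 2 = (q k + q l) ^ 2 - 4 * (q k * q l) * X := A4
    rw [this]
    nlinarith
  have A6 : ‖chf q t‖ ≤ ‖chf q t - (f k + f l)‖ + ‖f k + f l‖ := by
    simpa using norm_add_le (chf q t - (f k + f l)) (f k + f l)
  linarith

def Hset (w : ℕ → ℝ) (d : ℤ) : Prop :=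
  ∃ C : ℝ, 0 ≤ C ∧ ∀ q : ℕ → ℝ, (∀ k, 0 ≤ q k) → HasSum q 1 → (∀ k, w k ≤ q k) → ∀ t : ℝ,
    Real.sin (d * t / 2) ^ 2 ≤ C * (1 - ‖chf q t‖)

lemma sin_add_sq_le (a b : ℝ) : Real.sin (a + b) ^ 2 ≤ 2 * Real.sin a ^ 2 + 2 * Real.sin b ^ 2 := by
  have h : |Real.sin (a + b)| ≤ |Real.sin a| + |Real.sin b| := by
    rw [Real.sin_add]
    refine (abs_add_le _ _).trans (add_le_add ?_ ?_)
    · rw [abs_mul]; exact mul_le_of_le_one_right (abs_nonneg _) (Real.abs_cos_le_one _)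
    · rw [abs_mul]; exact mul_le_of_le_one_left (abs_nonneg _) (Real.abs_cos_le_one _)
  rw [← sq_abs (Real.sin (a + b)), ← sq_abs (Real.sin a), ← sq_abs (Real.sin b)]
  have := abs_nonneg (Real.sin (a + b))
  nlinarith [sq_nonneg (|Real.sin a| - |Real.sin b|)]

def Hgrp (w : ℕ → ℝ) : AddSubgroup ℤ where
  carrier := {d | Hset w d}
  zero_mem' := ⟨0, le_rfl, by intros; simp⟩
  neg_mem' := by
    rintro d ⟨C, hC, h⟩
    refine ⟨C, hC, fun q h0 h1 hw t => ?_⟩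
    have := h q h0 h1 hw t
    have e : ((-d : ℤ) : ℝ) * t / 2 = -((d : ℝ) * t / 2) := by push_cast; ring
    rw [e, Real.sin_neg, neg_sq]
    exact this
  add_mem' := by
    rintro d e ⟨C, hC, h⟩ ⟨C', hC', h'⟩
    refine ⟨2 * C + 2 * C', by positivity, fun q h0 h1 hw t => ?_⟩
    have A := h q h0 h1 hw t
    have B := h' q h0 h1 hw t
    have e : ((d + e : ℤ) : ℝ) * t / 2 = ((d : ℝ) * t / 2) + ((e : ℝ) * t / 2) := by push_cast; ring
    rw [e]
    refine (sin_add_sq_le _ _).trans ?_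
    linarith

lemma uniform_decay (p w : ℕ → ℝ) (hw : ∀ k, 0 < p k → 0 < w k)
    (hp_aperiodic : ¬ ∃ (a h : ℤ), 2 ≤ h ∧ ∀ k : ℕ, 0 < p k → h ∣ ((k : ℤ) - a)) :
    ∃ c : ℝ, 0 < c ∧ ∀ q : ℕ → ℝ, (∀ k, 0 ≤ q k) → HasSum q 1 → (∀ k, w k ≤ q k) → ∀ t : ℝ,
      |t| ≤ Real.pi → c * t ^ 2 ≤ 1 - ‖chf q t‖ := by
  have hmem : ∀ k l : ℕ, 0 < p k → 0 < p l → ((k : ℤ) - l) ∈ Hgrp w := by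
    intro k l hk hl
    rcases eq_or_ne k l with rfl | hkl
    · rw [sub_self]; exact zero_mem _
    have hk' := hw k hk
    have hl' := hw l hl
    refine ⟨(2 * (w k * w l))⁻¹, by positivity, fun q h0 h1 hwq t => ?_⟩
    have := pair_decay h0 h1 k l hkl t
    rw [inv_mul_eq_div, le_div_iff₀ (by positivity)]
    have h2 : w k * w l ≤ q k * q l := mul_le_mul (hwq k) (hwq l) hl'.le (h0 k)
    have h3 := mul_le_mul_of_nonneg_right h2 (sq_nonneg (Real.sin (((k : ℤ) - (l : ℤ) : ℤ) * t / 2)))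
    linarith
  have hone : (1 : ℤ) ∈ Hgrp w := by
    obtain ⟨k0, hk0⟩ : ∃ k, 0 < p k := by
      by_contra hcon
      push Not at hcon
      exact hp_aperiodic ⟨0, 2, le_rfl, fun k hk => absurd hk (not_lt.2 (hcon k))⟩
    obtain ⟨a, ha⟩ := Int.subgroup_cyclic (Hgrp w)
    have hdvd : ∀ k : ℕ, 0 < p k → a ∣ ((k : ℤ) - k0) := by
      intro k hk
      have := hmem k k0 hk hk0
      rw [ha, AddSubgroup.mem_closure_singleton] at this
      obtain ⟨n, hn⟩ := this
      exact ⟨n, by rw [← hn, smul_eq_mul, mul_comm]⟩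
    rcases eq_or_ne a 0 with rfl | ha0
    · refine absurd ⟨(k0 : ℤ), 2, le_rfl, fun k hk => ?_⟩ hp_aperiodic
      rw [zero_dvd_iff.1 (hdvd k hk)]
      exact dvd_zero _
    · by_cases h2 : 2 ≤ |a|
      · exact absurd ⟨(k0 : ℤ), |a|, h2, fun k hk => (abs_dvd _ _).2 (hdvd k hk)⟩ hp_aperiodic
      · have h1 : |a| = 1 := by
          have := abs_pos.2 ha0
          omega
        rw [ha, AddSubgroup.mem_closure_singleton]
        rcases abs_eq (by norm_num) |>.1 h1 with rfl | rfl
        · exact ⟨1, by simp⟩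
        · exact ⟨-1, by simp⟩
  obtain ⟨C, hC, h⟩ := hone
  have hpi := Real.pi_pos
  refine ⟨1 / (Real.pi ^ 2 * (C + 1)), by positivity, fun q h0 h1 hwq t ht => ?_⟩
  have A := h q h0 h1 hwq t
  have hN := norm_chf_le h0 h1 t
  have B : t ^ 2 / Real.pi ^ 2 ≤ Real.sin ((1 : ℤ) * t / 2) ^ 2 := by
    have e : Real.sin ((1 : ℤ) * t / 2) ^ 2 = Real.sin (|t| / 2) ^ 2 := by
      rcases abs_choice t with h | h <;> rw [h]
      · simp
      · rw [neg_div, Real.sin_neg]; simp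
    rw [e, ← sq_abs t, ← div_pow]
    have := Real.mul_le_sin (x := |t| / 2) (by positivity) (by linarith)
    refine pow_le_pow_left₀ (by positivity) (le_trans (le_of_eq ?_) this) 2
    field_simp
  have D : t ^ 2 / Real.pi ^ 2 ≤ (C + 1) * (1 - ‖chf q t‖) := by nlinarith
  have E : 1 / (Real.pi ^ 2 * (C + 1)) * t ^ 2 = (t ^ 2 / Real.pi ^ 2) / (C + 1) := by
    field_simp
  rw [E, div_le_iff₀ (by positivity)]
  linarith

section gen
variable {p : ℕ → ℝ} {ρ : ℝ}

lemma summ_mom (hp : ∀ k, 0 ≤ p k)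
    (hρ_conv : ∀ s : ℝ, 0 ≤ s → s < ρ → Summable (fun k : ℕ => p k * s ^ k))
    (m : ℕ) (s : ℝ) (hs : 0 ≤ s) (hsρ : s < ρ) :
    Summable (fun k : ℕ => (k : ℝ) ^ m * (p k * s ^ k)) := by
  set r := (s + ρ) / 2 with hr
  have hsr : s < r := by rw [hr]; linarith
  have hr0 : 0 < r := by linarith
  have hS := hρ_conv r hr0.le (by rw [hr]; linarith)
  have hg := summable_pow_mul_geometric_of_norm_lt_one (R := ℝ) m (r := s / r)
    (by rw [Real.norm_of_nonneg (by positivity), div_lt_one hr0]; exact hsr)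
  refine Summable.of_nonneg_of_le (fun k => ?_) (fun k => ?_) (hg.mul_left (∑' k, p k * r ^ k))
  · have := hp k; positivity
  · have h1 : p k * r ^ k ≤ ∑' k, p k * r ^ k :=
      hS.le_tsum k (fun j _ => mul_nonneg (hp j) (by positivity))
    calc (k : ℝ) ^ m * (p k * s ^ k) = (p k * r ^ k) * ((k : ℝ) ^ m * (s / r) ^ k) := by
          have e : s ^ k = r ^ k * (s / r) ^ k := by rw [← mul_pow, mul_div_cancel₀ _ hr0.ne']
          rw [e]; ring
      _ ≤ _ := mul_le_mul_of_nonneg_right h1 (by positivity)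

lemma gen_deriv1 (hp : ∀ k, 0 ≤ p k)
    (hρ_conv : ∀ s : ℝ, 0 ≤ s → s < ρ → Summable (fun k : ℕ => p k * s ^ k))
    (b : ℝ) (hb : 0 < b) (hbρ : b < ρ) :
    HasDerivAt (genFun p) (∑' k : ℕ, p k * ((k : ℝ) * b ^ (k - 1))) b := by
  set r := (b + ρ) / 2 with hr
  have hsr : b < r := by rw [hr]; linarith
  have hr0 : 0 < r := by linarith
  have hS := (summ_mom hp hρ_conv 1 r hr0.le (by rw [hr]; linarith)).mul_left (r⁻¹)
  refine hasDerivAt_tsum_of_isPreconnected hS (t := Set.Ioo 0 r) isOpen_Ioo isPreconnected_Ioo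
    (g := fun k y => p k * y ^ k) (g' := fun k y => p k * ((k : ℝ) * y ^ (k - 1)))
    (fun k y _ => (hasDerivAt_pow k y).const_mul _) (fun k y hy => ?_) ⟨hb, hsr⟩
    (hρ_conv b hb.le hbρ) ⟨hb, hsr⟩
  have hk := hp k
  have hy0 := hy.1
  rw [Real.norm_of_nonneg (by positivity)]
  rcases k with _ | k
  · simp
  · calc p (k + 1) * (((k + 1 : ℕ) : ℝ) * y ^ (k + 1 - 1))
        ≤ p (k + 1) * (((k + 1 : ℕ) : ℝ) * r ^ (k + 1 - 1)) := by
          have := hy.2.le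
          gcongr
      _ = _ := by rw [Nat.add_sub_cancel, pow_succ r]; field_simp

lemma gen_deriv2 (hp : ∀ k, 0 ≤ p k)
    (hρ_conv : ∀ s : ℝ, 0 ≤ s → s < ρ → Summable (fun k : ℕ => p k * s ^ k))
    (b : ℝ) (hb : 0 < b) (hbρ : b < ρ) :
    HasDerivAt (fun b => ∑' k : ℕ, p k * ((k : ℝ) * b ^ (k - 1)))
      (∑' k : ℕ, p k * ((k : ℝ) * (((k - 1 : ℕ) : ℝ) * b ^ (k - 1 - 1)))) b := by
  set r := (b + ρ) / 2 with hr
  have hsr : b < r := by rw [hr]; linarith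
  have hr0 : 0 < r := by linarith
  have hS := (summ_mom hp hρ_conv 2 r hr0.le (by rw [hr]; linarith)).mul_left ((r ^ 2)⁻¹)
  have hS1 : Summable (fun k : ℕ => p k * ((k : ℝ) * b ^ (k - 1))) := by
    have := (summ_mom hp hρ_conv 1 b hb.le hbρ).mul_left (b⁻¹)
    refine (summable_congr (fun k => ?_)).2 this
    rcases k with _ | k
    · simp
    · rw [Nat.add_sub_cancel, pow_succ b]; field_simp
  refine hasDerivAt_tsum_of_isPreconnected hS (t := Set.Ioo 0 r) isOpen_Ioo isPreconnected_Ioo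
    (g := fun k y => p k * ((k : ℝ) * y ^ (k - 1)))
    (g' := fun k y => p k * ((k : ℝ) * (((k - 1 : ℕ) : ℝ) * y ^ (k - 1 - 1))))
    (fun k y _ => ((hasDerivAt_pow (k - 1) y).const_mul _).const_mul _) (fun k y hy => ?_) ⟨hb, hsr⟩
    hS1 ⟨hb, hsr⟩
  have hk := hp k
  have hy0 := hy.1
  rw [Real.norm_of_nonneg (by positivity)]
  rcases k with _ | _ | k
  · simp
  · simp; positivity
  · have h1 : ((k + 1 + 1 - 1 : ℕ) : ℝ) ≤ ((k + 1 + 1 : ℕ) : ℝ) := by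
      exact_mod_cast Nat.sub_le _ _
    calc p (k + 1 + 1) * (((k + 1 + 1 : ℕ) : ℝ) * (((k + 1 + 1 - 1 : ℕ) : ℝ) * y ^ (k + 1 + 1 - 1 - 1)))
        ≤ p (k + 1 + 1) * (((k + 1 + 1 : ℕ) : ℝ) * (((k + 1 + 1 : ℕ) : ℝ) * r ^ (k + 1 + 1 - 1 - 1))) := by
          have := hy.2.le
          gcongr
      _ = _ := by
        have : k + 1 + 1 - 1 - 1 = k := by omega
        rw [this]; field_simp; ring

lemma gen_sum1 (hp : ∀ k, 0 ≤ p k)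
    (hρ_conv : ∀ s : ℝ, 0 ≤ s → s < ρ → Summable (fun k : ℕ => p k * s ^ k))
    (b : ℝ) (hb : 0 < b) (hbρ : b < ρ) :
    HasSum (fun k : ℕ => (k : ℝ) * (p k * b ^ k)) (b * deriv (genFun p) b) := by
  rw [(gen_deriv1 hp hρ_conv b hb hbρ).deriv, ← tsum_mul_left]
  have := (summ_mom hp hρ_conv 1 b hb.le hbρ).hasSum
  convert this using 1
  · funext k; rw [pow_one]
  · congr 1; funext k
    rcases k with _ | k
    · simp
    · rw [Nat.add_sub_cancel, pow_succ b]; ring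

lemma gen_sum2 (hp : ∀ k, 0 ≤ p k)
    (hρ_conv : ∀ s : ℝ, 0 ≤ s → s < ρ → Summable (fun k : ℕ => p k * s ^ k))
    (b : ℝ) (hb : 0 < b) (hbρ : b < ρ) :
    HasSum (fun k : ℕ => (k : ℝ) ^ 2 * (p k * b ^ k))
      (b ^ 2 * iteratedDeriv 2 (genFun p) b + b * deriv (genFun p) b) := by
  have h2 : iteratedDeriv 2 (genFun p) b =
      ∑' k : ℕ, p k * ((k : ℝ) * (((k - 1 : ℕ) : ℝ) * b ^ (k - 1 - 1))) := by
    rw [iteratedDeriv_succ, iteratedDeriv_one]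
    have : deriv (genFun p) =ᶠ[𝓝 b] fun b => ∑' k : ℕ, p k * ((k : ℝ) * b ^ (k - 1)) := by
      filter_upwards [Ioo_mem_nhds hb hbρ] with y hy
      exact (gen_deriv1 hp hρ_conv y hy.1 hy.2).deriv
    rw [this.deriv_eq, (gen_deriv2 hp hρ_conv b hb hbρ).deriv]
  have h1 := gen_sum1 hp hρ_conv b hb hbρ
  have hS := (summ_mom hp hρ_conv 2 b hb.le hbρ)
  have h3 := (hS.sub h1.summable).hasSum
  have h4 := h3.add h1
  rw [h2, ← tsum_mul_left]
  refine hasSum_of_eq h4 (fun k => ?_) ?_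
  · ring
  · congr 2; funext k
    rcases k with _ | _ | k
    · simp
    · simp
    · have : k + 1 + 1 - 1 - 1 = k := by omega
      rw [this, pow_succ b, pow_succ b, Nat.add_sub_cancel]
      push_cast
      ring

lemma genFun_pos (hp : ∀ k, 0 ≤ p k)
    (hρ_conv : ∀ s : ℝ, 0 ≤ s → s < ρ → Summable (fun k : ℕ => p k * s ^ k))
    (b : ℝ) (hb : 0 < b) (hbρ : b < ρ) (k : ℕ) :
    p k * b ^ k ≤ genFun p b :=
  (hρ_conv b hb.le hbρ).le_tsum k (fun j _ => mul_nonneg (hp j) (by positivity))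

/-- centered first moment vanishes -/
lemma psi_centered (hp : ∀ k, 0 ≤ p k)
    (hρ_conv : ∀ s : ℝ, 0 ≤ s → s < ρ → Summable (fun k : ℕ => p k * s ^ k))
    (b : ℝ) (hb : 0 < b) (hbρ : b < ρ) (m : ℝ) :
    HasSum (fun k : ℕ => ((k : ℝ) - m) * (p k * b ^ k)) (b * deriv (genFun p) b - m * genFun p b) := by
  have h := (gen_sum1 hp hρ_conv b hb hbρ).sub ((hρ_conv b hb.le hbρ).hasSum.mul_left m)
  exact hasSum_of_eq h (fun k => by ring) rfl

lemma psi_mono (hp : ∀ k, 0 ≤ p k)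
    (hρ_conv : ∀ s : ℝ, 0 ≤ s → s < ρ → Summable (fun k : ℕ => p k * s ^ k))
    (k0 : ℕ) (hk0 : 0 < p k0)
    (b c : ℝ) (hb : 0 < b) (hbc : b ≤ c) (hc : c < ρ) : PsiFun p b ≤ PsiFun p c := by
  have hc0 : 0 < c := by linarith
  have hG : ∀ y, 0 < y → y < ρ → 0 < genFun p y := fun y hy hyρ =>
    lt_of_lt_of_le (by positivity) (genFun_pos hp hρ_conv y hy hyρ k0)
  have hGb := hG b hb (by linarith)
  have hGc := hG c hc0 hc
  set m := PsiFun p c with hm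
  have h1 := psi_centered hp hρ_conv b hb (by linarith) m
  have h2 := psi_centered hp hρ_conv c hc0 hc m
  have h2' : c * deriv (genFun p) c - m * genFun p c = 0 := by
    rw [hm, PsiFun]; field_simp; ring
  rw [h2'] at h2
  have h3 := h2.mul_left ((b / c) ^ m)
  rw [mul_zero] at h3
  have hl0 : 0 < b / c := by positivity
  have hl1 : b / c ≤ 1 := (div_le_one hc0).2 hbc
  have h4 := hasSum_le (fun k => ?_) h1 h3
  · rw [PsiFun, div_le_iff₀ hGb]; linarith
  · have e : p k * b ^ k = p k * c ^ k * (b / c) ^ (k : ℝ) := by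
      rw [Real.rpow_natCast, div_pow]; field_simp
    rw [e]
    have hpc : 0 ≤ p k * c ^ k := mul_nonneg (hp k) (by positivity)
    have : ((k : ℝ) - m) * (b / c) ^ (k : ℝ) ≤ ((k : ℝ) - m) * (b / c) ^ m := by
      rcases le_total m k with h | h
      · exact mul_le_mul_of_nonneg_left (Real.rpow_le_rpow_of_exponent_ge hl0 hl1 h) (by linarith)
      · exact mul_le_mul_of_nonpos_left (Real.rpow_le_rpow_of_exponent_ge hl0 hl1 h) (by linarith)
    have := mul_le_mul_of_nonneg_left this hpc
    linarith

lemma psi_low (hp : ∀ k, 0 ≤ p k) (hρ : 0 < ρ)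
    (hρ_conv : ∀ s : ℝ, 0 ≤ s → s < ρ → Summable (fun k : ℕ => p k * s ^ k))
    (i : ℕ) (hi : 0 < p i) (hmin : ∀ k < i, p k = 0) (g : ℝ) (hg : (i : ℝ) < g) :
    ∃ b1, 0 < b1 ∧ b1 < ρ ∧ ∀ b, 0 < b → b ≤ b1 → PsiFun p b < g := by
  set r := ρ / 2 with hr
  have hr0 : 0 < r := by positivity
  have hrρ : r < ρ := by rw [hr]; linarith
  have hK := (summ_mom hp hρ_conv 1 r hr0.le hrρ).hasSum
  set K := ∑' k : ℕ, (k : ℝ) ^ 1 * (p k * r ^ k) with hKdef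
  have hK0 : 0 ≤ K := tsum_nonneg (fun k => by have := hp k; positivity)
  set L := K / (r ^ (i + 1) * p i) with hL
  have hL0 : 0 ≤ L := by positivity
  have hd : 0 < g - i := by linarith
  refine ⟨min r ((g - i) / (L + 1)), by positivity, lt_of_le_of_lt (min_le_left _ _) hrρ, ?_⟩
  intro b hb hb1
  have hbr : b ≤ r := hb1.trans (min_le_left _ _)
  have hbL : b ≤ (g - i) / (L + 1) := hb1.trans (min_le_right _ _)
  rw [le_div_iff₀ (by positivity)] at hbL
  have hbρ : b < ρ := by linarith
  have hG := genFun_pos hp hρ_conv b hb hbρ i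
  have hG0 : 0 < genFun p b := lt_of_lt_of_le (by positivity) hG
  have h1 := psi_centered hp hρ_conv b hb hbρ i
  have h2 := hasSum_le (fun k => ?_) h1 (hK.mul_left ((b / r) ^ (i + 1)))
  · have e : (b / r) ^ (i + 1) * K = b * L * (p i * b ^ i) := by
      rw [hL, div_pow]; field_simp; ring
    rw [e] at h2
    have h3 : b * L * (p i * b ^ i) ≤ b * L * genFun p b :=
      mul_le_mul_of_nonneg_left hG (by positivity)
    rw [PsiFun, div_lt_iff₀ hG0]
    have h4 : b * L * genFun p b < (g - i) * genFun p b :=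
      mul_lt_mul_of_pos_right (by linarith) hG0
    linarith
  · have hk := hp k
    rcases lt_trichotomy k i with h | h | h
    · rw [hmin k h]; simp
    · subst h
      rw [sub_self, zero_mul]; positivity
    · obtain ⟨d, rfl⟩ := Nat.exists_eq_add_of_le (Nat.succ_le_of_lt h)
      have e : (b / r) ^ (i + 1) * (((i.succ + d : ℕ) : ℝ) ^ 1 * (p (i.succ + d) * r ^ (i.succ + d)))
          = ((i.succ + d : ℕ) : ℝ) * (p (i.succ + d) * (b ^ (i + 1) * r ^ d)) := by
        rw [div_pow, pow_add r, Nat.succ_eq_add_one]; field_simp; ring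
      rw [e, pow_add b, Nat.succ_eq_add_one]
      have hi0 : (0 : ℝ) ≤ i := by positivity
      gcongr
      linarith

lemma good_tilt (hp : ∀ k, 0 ≤ p k)
    (hρ_conv : ∀ s : ℝ, 0 ≤ s → s < ρ → Summable (fun k : ℕ => p k * s ^ k))
    (hp_aperiodic : ¬ ∃ (a h : ℤ), 2 ≤ h ∧ ∀ k : ℕ, 0 < p k → h ∣ ((k : ℤ) - a))
    (k0 : ℕ) (hk0 : 0 < p k0)
    (b1 b0 : ℝ) (hb1 : 0 < b1) (hb1ρ : b1 < ρ) (hb0 : 0 < b0) (hb0ρ : b0 < ρ) :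
    ∃ c M : ℝ, 0 < c ∧ 0 ≤ M ∧ ∀ b, b1 ≤ b → b ≤ b0 →
      Good (fun k => p k * b ^ k / genFun p b) (PsiFun p b)
        ((b ^ 2 * iteratedDeriv 2 (genFun p) b + b * deriv (genFun p) b)
            / genFun p b - (b * deriv (genFun p) b / genFun p b) ^ 2) c M := by
  have hG : ∀ y, 0 < y → y < ρ → 0 < genFun p y := fun y hy hyρ =>
    lt_of_lt_of_le (by positivity) (genFun_pos hp hρ_conv y hy hyρ k0)
  have hG1 := hG b1 hb1 hb1ρ
  have hG0 := hG b0 hb0 hb0ρ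
  have hGmono : ∀ y z, 0 < y → y ≤ z → z < ρ → genFun p y ≤ genFun p z := by
    intro y z hy hyz hz
    refine (hρ_conv y hy.le (by linarith)).tsum_le_tsum (fun k => ?_) (hρ_conv z (by linarith) hz)
    have := hp k
    gcongr
  obtain ⟨c, hc, hdec⟩ := uniform_decay p (fun k => p k * b1 ^ k / genFun p b0)
    (fun k hk => by positivity) hp_aperiodic
  set T := ∑' k : ℕ, (k : ℝ) ^ 3 * (p k * b0 ^ k) with hT
  have hTs := (summ_mom hp hρ_conv 3 b0 hb0.le hb0ρ)
  have hT0 : 0 ≤ T := tsum_nonneg (fun k => by have := hp k; positivity)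
  have hm0 : ∀ b, 0 < b → b < ρ → 0 ≤ PsiFun p b := by
    intro b hb hbρ
    refine div_nonneg ?_ (hG b hb hbρ).le
    exact (gen_sum1 hp hρ_conv b hb hbρ).nonneg (fun k => by have := hp k; positivity)
  have hm00 := hm0 b0 hb0 hb0ρ
  refine ⟨c, 4 * (T / genFun p b1) + 4 * PsiFun p b0 ^ 3, hc, by positivity, fun b hbl hbu => ?_⟩
  have hb : 0 < b := by linarith
  have hbρ : b < ρ := by linarith
  have hGb := hG b hb hbρ
  have hmb := hm0 b hb hbρ
  have hmle := psi_mono hp hρ_conv k0 hk0 b b0 hb hbu hb0ρ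
  set m := PsiFun p b with hm
  have hmG : m * genFun p b = b * deriv (genFun p) b := by rw [hm, PsiFun]; field_simp
  have hq0 : ∀ k, 0 ≤ p k * b ^ k / genFun p b := fun k => by have := hp k; positivity
  have hq1 : HasSum (fun k => p k * b ^ k / genFun p b) 1 := by
    have := (hρ_conv b hb.le hbρ).hasSum.div_const (genFun p b)
    exact hasSum_of_eq this (fun k => rfl) (div_self hGb.ne').symm
  have h3le : ∀ k : ℕ, p k * b ^ k / genFun p b * |(k : ℝ) - m| ^ 3 ≤
      4 / genFun p b1 * ((k : ℝ) ^ 3 * (p k * b0 ^ k)) + 4 * PsiFun p b0 ^ 3 * (p k * b ^ k / genFun p b) := by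
    intro k
    have hk : (0 : ℝ) ≤ k := by positivity
    have hpk := hp k
    have e1 : |(k : ℝ) - m| ≤ k + m := by rw [abs_le]; constructor <;> linarith
    have e2 : |(k : ℝ) - m| ^ 3 ≤ 4 * k ^ 3 + 4 * PsiFun p b0 ^ 3 := by
      have e3 : |(k : ℝ) - m| ^ 3 ≤ (k + m) ^ 3 := pow_le_pow_left₀ (abs_nonneg _) e1 3
      have e4 : m ^ 3 ≤ PsiFun p b0 ^ 3 := pow_le_pow_left₀ hmb hmle 3
      have e5 : ((k : ℝ) + m) ^ 3 ≤ 4 * k ^ 3 + 4 * m ^ 3 := by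
        nlinarith [mul_nonneg (add_nonneg hk hmb) (sq_nonneg ((k : ℝ) - m))]
      linarith
    have e6 : p k * b ^ k / genFun p b ≤ p k * b0 ^ k / genFun p b1 := by
      have := hGmono b1 b hb1 hbl hbρ
      gcongr
    have e7 := mul_le_mul_of_nonneg_left e2 (hq0 k)
    have e8 := mul_le_mul_of_nonneg_right e6 (by positivity : 0 ≤ 4 * (k : ℝ) ^ 3)
    refine e7.trans ?_
    rw [mul_add]
    refine add_le_add (e8.trans (le_of_eq ?_)) (le_of_eq ?_)
    · field_simp
    · ring
  have h3s := (hTs.hasSum.mul_left (4 / genFun p b1)).add (hq1.mul_left (4 * PsiFun p b0 ^ 3))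
  have h3 : Summable (fun k : ℕ => p k * b ^ k / genFun p b * |(k : ℝ) - m| ^ 3) :=
    Summable.of_nonneg_of_le (fun k => mul_nonneg (hq0 k) (by positivity)) h3le h3s.summable
  refine ⟨hq0, hq1, ?_, ?_, h3, ?_, ?_⟩
  · have := (psi_centered hp hρ_conv b hb hbρ m).div_const (genFun p b)
    rw [hmG, sub_self, zero_div] at this
    exact hasSum_of_eq this (fun k => by ring) rfl
  · have A := gen_sum2 hp hρ_conv b hb hbρ
    have B := (gen_sum1 hp hρ_conv b hb hbρ).mul_left (2 * m)
    have C := (hρ_conv b hb.le hbρ).hasSum.mul_left (m ^ 2)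
    have D := ((A.sub B).add C).div_const (genFun p b)
    refine hasSum_of_eq D (fun k => ?_) ?_
    · ring
    · have : ∑' k, p k * b ^ k = genFun p b := rfl
      rw [this, ← hmG]
      field_simp
      ring
  · refine (hasSum_le h3le h3.hasSum h3s).trans (le_of_eq ?_)
    rw [← hT]; ring
  · refine hdec _ hq0 hq1 (fun k => ?_)
    have := hp k
    have := hGmono b b0 hb hbu hb0ρ
    gcongr

end gen

theorem bulk_regime_local_limit_theorem
    (p : ℕ → ℝ) (hp_nonneg : ∀ k, 0 ≤ p k) (hp_prob : ∑' k : ℕ, p k = 1)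
    (hp_aperiodic : ¬ ∃ (a h : ℤ), 2 ≤ h ∧ ∀ k : ℕ, 0 < p k → h ∣ ((k : ℤ) - a))
    (ρ : ℝ) (hρ : 0 < ρ)
    (hρ_conv : ∀ s : ℝ, 0 ≤ s → s < ρ → Summable (fun k : ℕ => p k * s ^ k))
    (hρ_div : ∀ s : ℝ, ρ < s → ¬ Summable (fun k : ℕ => p k * s ^ k))
    (x : ℕ → ℕ) (hx_pos : ∀ n, 1 ≤ x n)
    (γ : ℝ) (hγ : Tendsto (fun n : ℕ => (x n : ℝ) / n) atTop (𝓝 γ))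
    (hγ_low : ((sInf {k : ℕ | 0 < p k} : ℕ) : ℝ) < γ)
    (hγ_high : ∃ b₀ ∈ Set.Ioo (0 : ℝ) ρ, γ < PsiFun p b₀)
    (b : ℕ → ℝ)
    (hb : ∀ᶠ n in atTop, b n ∈ Set.Ioo (0 : ℝ) ρ ∧ PsiFun p (b n) = (x n : ℝ) / n)
    (v : ℕ → ℝ) (hv_nonneg : ∀ n, 0 ≤ v n)
    (hv : ∀ᶠ n in atTop,
      (v n) ^ 2 = (n : ℝ) *
        (((b n) ^ 2 * iteratedDeriv 2 (genFun p) (b n) + b n * deriv (genFun p) (b n))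
            / genFun p (b n)
          - (b n * deriv (genFun p) (b n) / genFun p (b n)) ^ 2)) :
    ∀ ε > 0, ∀ᶠ n in atTop, ∀ j : ℕ,
      |v n * ((b n) ^ j / (genFun p (b n)) ^ n) * convPow p n j -
        (Real.sqrt (2 * Real.pi))⁻¹ *
          Real.exp (-((j : ℝ) - (x n : ℝ)) ^ 2 / (2 * (v n) ^ 2))| < ε := by
  have hne : {k : ℕ | 0 < p k}.Nonempty := by
    by_contra hcon
    rw [Set.not_nonempty_iff_eq_empty] at hcon
    refine hp_aperiodic ⟨0, 2, le_rfl, fun k hk => ?_⟩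
    have : k ∈ {k : ℕ | 0 < p k} := hk
    rw [hcon] at this
    exact absurd this (Set.notMem_empty k)
  set i := sInf {k : ℕ | 0 < p k} with hi
  have hip : 0 < p i := Nat.sInf_mem hne
  have himin : ∀ k < i, p k = 0 := by
    intro k hk
    have : ¬ 0 < p k := fun h => absurd (Nat.sInf_le h) (not_le.2 hk)
    exact le_antisymm (not_lt.1 this) (hp_nonneg k)
  obtain ⟨b0, ⟨hb0, hb0ρ⟩, hγb0⟩ := hγ_high
  obtain ⟨b1, hb1, hb1ρ, hlow⟩ := psi_low hp_nonneg hρ hρ_conv i hip himin (((i : ℝ) + γ) / 2)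
    (by linarith)
  obtain ⟨c, M, hc, hM, hgood⟩ := good_tilt hp_nonneg hρ_conv hp_aperiodic i hip b1 b0 hb1 hb1ρ hb0 hb0ρ
  have hrange : ∀ᶠ n in atTop, b1 ≤ b n ∧ b n ≤ b0 := by
    filter_upwards [hb, hγ.eventually_lt_const hγb0,
      hγ.eventually_const_lt (by linarith : ((i : ℝ) + γ) / 2 < γ)] with n hn h1 h2
    constructor
    · by_contra hcon
      have := hlow (b n) hn.1.1 (le_of_lt (not_le.1 hcon))
      linarith [hn.2]
    · by_contra hcon
      have := psi_mono hp_nonneg hρ_conv i hip b0 (b n) hb0 (le_of_lt (not_le.1 hcon)) hn.1.2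
      linarith [hn.2]
  have key := uniform_llt (fun n k => p k * (b n) ^ k / genFun p (b n)) (fun n => PsiFun p (b n))
    (fun n => ((b n) ^ 2 * iteratedDeriv 2 (genFun p) (b n) + b n * deriv (genFun p) (b n))
            / genFun p (b n)
          - (b n * deriv (genFun p) (b n) / genFun p (b n)) ^ 2) v c M hc hM
    (by filter_upwards [hrange] with n hn; exact hgood (b n) hn.1 hn.2) hv_nonneg hv
  intro ε hε
  filter_upwards [key ε hε, hb, eventually_gt_atTop 0] with n hn hbn hn0 j
  have h := hn j
  have hbp := hbn.1.1
  have hGb : genFun p (b n) ≠ 0 := (lt_of_lt_of_le (by positivity)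
    (genFun_pos hp_nonneg hρ_conv (b n) hbp hbn.1.2 i)).ne'
  rw [convPow_tilt p hGb, hbn.2, mul_div_cancel₀ _ (by positivity : (n : ℝ) ≠ 0), ← mul_assoc] at h
  exact h
end

section
/- Asymptotics of the tilting parameter and moments in the small endpoint regime. Assume P(ξ=0) > 0 and P(ξ=1) > 0, and let (x_n) be positive integers with x_n → ∞ and x_n/n → 0; for n large let b_n ∈ (0,ρ) be defined by b_nG'(b_n)/G(b_n) = x_n/n. Then, as n → ∞: b_n ∼ (P(ξ=0)/P(ξ=1))·(x_n/n); E[(ξ^{(b_n)})²] ∼ x_n/n; E[(ξ^{(b_n)})³] = O(x_n/n); P(ξ^{(b_n)}=0) → 1; and P(ξ^{(b_n)}=1) ∼ x_n/n. -/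
set_option autoImplicit false

open Filter Topology

/-- `P(ξ^{(b)} = k) = b^k p k / G(b)`: the exponentially tilted law. -/
noncomputable def tiltProb (p : ℕ → ℝ) (b : ℝ) (k : ℕ) : ℝ := b ^ k * p k / genFun p b

/-- The variance of the tilted variable `ξ^{(b)}`. -/
noncomputable def tiltVar (p : ℕ → ℝ) (b : ℝ) : ℝ :=
  (∑' k : ℕ, (k : ℝ) ^ 2 * tiltProb p b k) - (∑' k : ℕ, (k : ℝ) * tiltProb p b k) ^ 2

/-- The characteristic function `φ(t) = E[exp(itξ^{(b)})] = G(b e^{it})/G(b)`. -/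
noncomputable def charFn (p : ℕ → ℝ) (b : ℝ) (t : ℝ) : ℂ :=
  (∑' k : ℕ, (p k : ℂ) * ((b : ℂ) * Complex.exp (Complex.I * (t : ℂ))) ^ k) /
    ((genFun p b : ℝ) : ℂ)

/-- The `j`-th moment of the tilted variable `ξ^{(b)}`. -/
noncomputable def tiltMom (p : ℕ → ℝ) (b : ℝ) (j : ℕ) : ℝ :=
  ∑' k : ℕ, (k : ℝ) ^ j * tiltProb p b k

lemma summable_mom (p : ℕ → ℝ) (hp : ∀ k, 0 ≤ p k) (ρ : ℝ)
    (hc : ∀ s : ℝ, 0 ≤ s → s < ρ → Summable (fun k : ℕ => p k * s ^ k))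
    (j : ℕ) (s : ℝ) (hs : 0 ≤ s) (hsρ : s < ρ) :
    Summable (fun k : ℕ => (k : ℝ) ^ j * (p k * s ^ k)) := by
  obtain ⟨t, hst, htρ⟩ := exists_between hsρ
  have ht : 0 < t := lt_of_le_of_lt hs hst
  have hlim : Tendsto (fun k : ℕ => (k : ℝ) ^ j * (s / t) ^ k) atTop (𝓝 0) := by
    apply tendsto_pow_const_mul_const_pow_of_abs_lt_one
    rw [abs_of_nonneg (by positivity), div_lt_one ht]
    exact hst
  have hev : ∀ᶠ k : ℕ in atTop, (k : ℝ) ^ j * (s / t) ^ k < 1 :=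
    hlim.eventually_lt_const zero_lt_one
  refine Summable.of_norm_bounded_eventually_nat (hc t ht.le htρ) ?_
  filter_upwards [hev] with k hk
  have h1 := hp k
  rw [Real.norm_of_nonneg (by positivity)]
  have h2 : (k : ℝ) ^ j * (p k * s ^ k) = ((k : ℝ) ^ j * (s / t) ^ k) * (p k * t ^ k) := by
    rw [div_pow]
    field_simp
  rw [h2]
  exact mul_le_of_le_one_left (by positivity) hk.le

lemma mul_deriv_genFun (p : ℕ → ℝ) (hp : ∀ k, 0 ≤ p k) (ρ : ℝ)
    (hc : ∀ s : ℝ, 0 ≤ s → s < ρ → Summable (fun k : ℕ => p k * s ^ k))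
    (s : ℝ) (hs : 0 < s) (hsρ : s < ρ) :
    s * deriv (genFun p) s = ∑' k : ℕ, (k : ℝ) ^ 1 * (p k * s ^ k) := by
  obtain ⟨t, hst, htρ⟩ := exists_between hsρ
  have ht : 0 < t := hs.trans hst
  have hpow : ∀ (y : ℝ), y ≠ 0 → ∀ k : ℕ,
      y⁻¹ * ((k : ℝ) ^ 1 * (p k * y ^ k)) = p k * ((k : ℝ) * y ^ (k - 1)) := by
    intro y hy k
    cases k with
    | zero => simp
    | succ k => simp only [Nat.add_sub_cancel, pow_succ]; field_simp
  have hu : Summable (fun k : ℕ => p k * ((k : ℝ) * t ^ (k - 1))) := by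
    have := (summable_mom p hp ρ hc 1 t ht.le htρ).mul_left t⁻¹
    refine this.congr (fun k => hpow t ht.ne' k)
  have hd : HasDerivAt (fun z => ∑' k : ℕ, p k * z ^ k)
      (∑' k : ℕ, p k * ((k : ℝ) * s ^ (k - 1))) s := by
    refine hasDerivAt_tsum_of_isPreconnected (t := Set.Ioo 0 t) (y₀ := s)
      (g := fun k z => p k * z ^ k) (g' := fun k z => p k * ((k : ℝ) * z ^ (k - 1)))
      hu isOpen_Ioo isPreconnected_Ioo ?_ ?_ ⟨hs, hst⟩ (hc s hs.le hsρ) ⟨hs, hst⟩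
    · intro k y _
      exact (hasDerivAt_pow k y).const_mul (p k)
    · intro k y hy
      have h0 := hp k
      have h1 := hy.1
      have h2 := hy.2.le
      rw [Real.norm_of_nonneg (by positivity)]
      gcongr
  have hd' : deriv (genFun p) s = ∑' k : ℕ, p k * ((k : ℝ) * s ^ (k - 1)) := hd.deriv
  rw [hd', ← tsum_mul_left]
  refine tsum_congr (fun k => ?_)
  rw [← hpow s hs.ne' k]
  field_simp

/-- The weighted sums are `p 1 * s + O(s ^ 2)`. -/
lemma mom_bounds (p : ℕ → ℝ) (hp : ∀ k, 0 ≤ p k) (ρ : ℝ)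
    (hc : ∀ s : ℝ, 0 ≤ s → s < ρ → Summable (fun k : ℕ => p k * s ^ k))
    (j : ℕ) (hj : j ≠ 0) (r : ℝ) (hr : 0 < r) (hrρ : r < ρ) :
    ∃ C : ℝ, ∀ s : ℝ, 0 < s → s ≤ r →
      p 1 * s ≤ ∑' k : ℕ, (k : ℝ) ^ j * (p k * s ^ k) ∧
      ∑' k : ℕ, (k : ℝ) ^ j * (p k * s ^ k) ≤ p 1 * s + C * s ^ 2 := by
  have hsum := summable_mom p hp ρ hc j
  refine ⟨(∑' k : ℕ, ((k + 2 : ℕ) : ℝ) ^ j * (p (k + 2) * r ^ (k + 2))) / r ^ 2, ?_⟩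
  intro s hs hsr
  have hS := hsum s hs.le (lt_of_le_of_lt hsr hrρ)
  have hR := hsum r hr.le hrρ
  have hS2 := (summable_nat_add_iff 2).2 hS
  have hR2 := (summable_nat_add_iff 2).2 hR
  have hsplit := hS.sum_add_tsum_nat_add 2
  simp only [Finset.sum_range_succ, Finset.sum_range_zero, Nat.cast_zero, Nat.cast_one, one_pow,
    zero_pow hj, pow_one, zero_mul, one_mul, zero_add] at hsplit
  rw [← hsplit]
  constructor
  · have : 0 ≤ ∑' k : ℕ, ((k + 2 : ℕ) : ℝ) ^ j * (p (k + 2) * s ^ (k + 2)) :=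
      tsum_nonneg (fun k => by have := hp (k + 2); positivity)
    linarith
  · gcongr
    rw [div_mul_eq_mul_div, mul_div_assoc, ← tsum_mul_right]
    refine hS2.tsum_le_tsum ?_ (hR2.mul_right _)
    intro k
    have h0 := hp (k + 2)
    have h1 : s ^ k ≤ r ^ k := by gcongr
    have h2 : ((k + 2 : ℕ) : ℝ) ^ j * (p (k + 2) * r ^ (k + 2)) * (s ^ 2 / r ^ 2)
      = ((k + 2 : ℕ) : ℝ) ^ j * (p (k + 2) * (r ^ k * s ^ 2)) := by
      rw [pow_add]; field_simp
    rw [h2, pow_add]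
    gcongr

open Asymptotics in
/-- **Asymptotics of the tilting parameter and moments in the small endpoint regime**:
if `P(ξ=0), P(ξ=1) > 0`, `x_n → ∞` and `x_n/n → 0`, then `b_n ∼ (P(ξ=0)/P(ξ=1))·(x_n/n)`,
`E[(ξ^{(b_n)})²] ∼ x_n/n`, `E[(ξ^{(b_n)})³] = O(x_n/n)`, `P(ξ^{(b_n)}=0) → 1` and
`P(ξ^{(b_n)}=1) ∼ x_n/n`. -/
theorem tilting_asymptotics_small_endpoint
    (p : ℕ → ℝ) (hp_nonneg : ∀ k, 0 ≤ p k) (hp_prob : ∑' k : ℕ, p k = 1)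
    (hp_aperiodic : ¬ ∃ (a h : ℤ), 2 ≤ h ∧ ∀ k : ℕ, 0 < p k → h ∣ ((k : ℤ) - a))
    (ρ : ℝ) (hρ : 0 < ρ)
    (hρ_conv : ∀ s : ℝ, 0 ≤ s → s < ρ → Summable (fun k : ℕ => p k * s ^ k))
    (hρ_div : ∀ s : ℝ, ρ < s → ¬ Summable (fun k : ℕ => p k * s ^ k))
    (hp0 : 0 < p 0) (hp1 : 0 < p 1)
    (x : ℕ → ℕ) (hx_pos : ∀ n, 1 ≤ x n)
    (hx_infty : Tendsto (fun n : ℕ => (x n : ℝ)) atTop atTop)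
    (hx_small : Tendsto (fun n : ℕ => (x n : ℝ) / n) atTop (𝓝 0))
    (b : ℕ → ℝ)
    (hb : ∀ᶠ n in atTop, b n ∈ Set.Ioo (0 : ℝ) ρ ∧ PsiFun p (b n) = (x n : ℝ) / n) :
    Tendsto (fun n : ℕ => b n / ((p 0 / p 1) * ((x n : ℝ) / n))) atTop (𝓝 1) ∧
    Tendsto (fun n : ℕ => tiltMom p (b n) 2 / ((x n : ℝ) / n)) atTop (𝓝 1) ∧
    (fun n : ℕ => tiltMom p (b n) 3) =O[atTop] (fun n : ℕ => (x n : ℝ) / n) ∧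
    Tendsto (fun n : ℕ => tiltProb p (b n) 0) atTop (𝓝 1) ∧
    Tendsto (fun n : ℕ => tiltProb p (b n) 1 / ((x n : ℝ) / n)) atTop (𝓝 1) := by
  have hG : ∀ s : ℝ, 0 < s → s < ρ → p 0 + p 1 * s ≤ genFun p s := by
    intro s hs hsρ
    have h := (hρ_conv s hs.le hsρ).sum_le_tsum (Finset.range 2)
      (fun k _ => mul_nonneg (hp_nonneg k) (by positivity))
    simpa [Finset.sum_range_succ, genFun] using h
  have hS1 : ∀ s : ℝ, 0 < s → s < ρ →
      genFun p s - p 0 ≤ ∑' k : ℕ, (k : ℝ) ^ 1 * (p k * s ^ k) := by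
    intro s hs hsρ
    have hs0 := hρ_conv s hs.le hsρ
    have hs1 := summable_mom p hp_nonneg ρ hρ_conv 1 s hs.le hsρ
    have e0 := hs0.tsum_eq_zero_add
    have e1 := hs1.tsum_eq_zero_add
    simp only [pow_zero, mul_one] at e0
    have e1' : ∑' k : ℕ, (k : ℝ) ^ 1 * (p k * s ^ k)
        = ∑' k : ℕ, ((k + 1 : ℕ) : ℝ) ^ 1 * (p (k + 1) * s ^ (k + 1)) := by
      rw [e1]; simp
    rw [e1', genFun, e0, add_sub_cancel_left]
    refine ((summable_nat_add_iff 1).2 hs0).tsum_le_tsum ?_ ((summable_nat_add_iff 1).2 hs1)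
    intro k
    have h0 := hp_nonneg (k + 1)
    refine le_mul_of_one_le_left (by positivity) ?_
    rw [pow_one]
    push_cast
    linarith [(Nat.cast_nonneg k : (0 : ℝ) ≤ k)]
  have hM : ∀ s : ℝ, ∀ j : ℕ,
      tiltMom p s j = (∑' k : ℕ, (k : ℝ) ^ j * (p k * s ^ k)) / genFun p s := by
    intro s j
    rw [tiltMom, ← tsum_div_const]
    refine tsum_congr (fun k => ?_)
    rw [tiltProb]; ring
  have hPsi : ∀ s : ℝ, 0 < s → s < ρ → PsiFun p s = tiltMom p s 1 := by
    intro s hs hsρ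
    rw [hM, PsiFun, mul_deriv_genFun p hp_nonneg ρ hρ_conv s hs hsρ]
  set y : ℕ → ℝ := fun n => (x n : ℝ) / n with hy
  have hylt : ∀ᶠ n in atTop, y n < 1 := hx_small.eventually_lt_const zero_lt_one
  -- the generating function is squeezed
  have hGle : ∀ᶠ n in atTop, genFun p (b n) ≤ p 0 / (1 - y n) := by
    filter_upwards [hb, hylt] with n hn hyn
    obtain ⟨⟨h0, h1⟩, h2⟩ := hn
    have hg := hG _ h0 h1
    have hgpos : 0 < genFun p (b n) := lt_of_lt_of_le (by positivity) hg
    rw [hPsi _ h0 h1, hM, div_eq_iff hgpos.ne'] at h2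
    have h3 := hS1 _ h0 h1
    rw [h2] at h3
    rw [le_div_iff₀ (by linarith)]
    have : (x n : ℝ) / n = y n := rfl
    rw [this] at h3
    linarith
  have hlimU : Tendsto (fun n => p 0 / (1 - y n)) atTop (𝓝 (p 0)) := by
    have : Tendsto (fun n => p 0 / (1 - y n)) atTop (𝓝 (p 0 / (1 - 0))) :=
      tendsto_const_nhds.div (tendsto_const_nhds.sub hx_small) (by norm_num)
    simpa using this
  have hGlim : Tendsto (fun n => genFun p (b n)) atTop (𝓝 (p 0)) := by
    refine tendsto_of_tendsto_of_tendsto_of_le_of_le' tendsto_const_nhds hlimU ?_ hGle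
    filter_upwards [hb] with n hn
    have := hG _ hn.1.1 hn.1.2
    nlinarith [hn.1.1]
  have hblim : Tendsto b atTop (𝓝 0) := by
    have hU : Tendsto (fun n => (genFun p (b n) - p 0) / p 1) atTop (𝓝 0) := by
      have := (hGlim.sub_const (p 0)).div_const (p 1)
      simpa using this
    refine tendsto_of_tendsto_of_tendsto_of_le_of_le' tendsto_const_nhds hU ?_ ?_
    · filter_upwards [hb] with n hn using hn.1.1.le
    · filter_upwards [hb] with n hn
      have := hG _ hn.1.1 hn.1.2
      rw [le_div_iff₀ hp1]
      linarith
  have hSlim : ∀ j : ℕ, j ≠ 0 →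
      Tendsto (fun n => tiltMom p (b n) j / b n) atTop (𝓝 (p 1 / p 0)) := by
    intro j hj
    obtain ⟨C, hC⟩ := mom_bounds p hp_nonneg ρ hρ_conv j hj (ρ / 2) (by linarith) (by linarith)
    have hq : Tendsto (fun n => (∑' k : ℕ, (k : ℝ) ^ j * (p k * b n ^ k)) / b n) atTop
        (𝓝 (p 1)) := by
      have hU : Tendsto (fun n => p 1 + C * b n) atTop (𝓝 (p 1)) := by
        have := (hblim.const_mul C).const_add (p 1)
        simpa using this
      have hbr : ∀ᶠ n in atTop, b n < ρ / 2 := hblim.eventually_lt_const (by linarith)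
      refine tendsto_of_tendsto_of_tendsto_of_le_of_le' tendsto_const_nhds hU ?_ ?_
      · filter_upwards [hb, hbr] with n hn hr
        rw [le_div_iff₀ hn.1.1]
        exact (hC _ hn.1.1 hr.le).1
      · filter_upwards [hb, hbr] with n hn hr
        rw [div_le_iff₀ hn.1.1]
        have := (hC _ hn.1.1 hr.le).2
        linarith
    refine (hq.div hGlim hp0.ne').congr (fun n => ?_)
    simp only [Pi.div_apply]
    rw [hM, div_right_comm]
  have hyb : Tendsto (fun n => y n / b n) atTop (𝓝 (p 1 / p 0)) := by
    refine (hSlim 1 one_ne_zero).congr' ?_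
    filter_upwards [hb] with n hn
    rw [← hPsi _ hn.1.1 hn.1.2, hn.2]
  have hne : p 1 / p 0 ≠ 0 := by positivity
  have hmom : ∀ j : ℕ, j ≠ 0 → Tendsto (fun n => tiltMom p (b n) j / y n) atTop (𝓝 1) := by
    intro j hj
    have h := (hSlim j hj).div hyb hne
    rw [div_self hne] at h
    refine h.congr' ?_
    filter_upwards [hb] with n hn
    simp only [Pi.div_apply]
    exact div_div_div_cancel_right₀ hn.1.1.ne' _ _
  have hypos : ∀ᶠ n in atTop, 0 < y n := by
    filter_upwards [eventually_gt_atTop 0] with n hn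
    have h1 : (0 : ℝ) < x n := by exact_mod_cast hx_pos n
    have h2 : (0 : ℝ) < n := by exact_mod_cast hn
    exact div_pos h1 h2
  have hby : Tendsto (fun n => b n / y n) atTop (𝓝 (p 0 / p 1)) := by
    have := hyb.inv₀ hne
    simpa using this
  refine ⟨?_, hmom 2 two_ne_zero, ?_, ?_, ?_⟩
  · have h := hby.div_const (p 0 / p 1)
    rw [div_self (by positivity)] at h
    refine h.congr (fun n => ?_)
    rw [div_div, mul_comm (y n)]
  · refine isBigO_of_div_tendsto_nhds ?_ 1 (hmom 3 three_ne_zero)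
    filter_upwards [hypos] with n hn h0
    exact absurd h0 hn.ne'
  · have h := (tendsto_const_nhds (x := p 0)).div hGlim hp0.ne'
    rw [div_self hp0.ne'] at h
    refine h.congr (fun n => ?_)
    simp [tiltProb]
  · have h := ((tendsto_const_nhds (x := p 1)).div hGlim hp0.ne').mul hby
    have e : p 1 / p 0 * (p 0 / p 1) = 1 := by field_simp
    rw [e] at h
    refine h.congr (fun n => ?_)
    simp only [tiltProb, Pi.div_apply, pow_one]
    ring
end
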